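/- Let K ⊆ ℝᵈ be a bounded convex open set with diameter h_K. Then for every q ∈ H¹(K) with ∫_K q dx = 0, ‖q‖_{L²(K)} ≤ (h_K/π)·‖∇q‖_{L²(K)}, and in particular ‖q‖_{L²(K)} ≤ h_K·‖∇q‖_{L²(K)}. -/

import Mathlib

open MeasureTheory
open scoped ENNReal

/-- Wirtinger's inequality on an interval with respect to a positive log-concave weight. -/
theorem wirtinger_of_logConcave_weight {a b κ : ℝ} (hab : a ≤ b) (hκ : 0 < κ)
    (hκab : κ * (b - a) < Real.pi) {p p' p'' g g' : ℝ → ℝ}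
    (hp : ∀ x, HasDerivAt p (p' x) x) (hp' : ∀ x, HasDerivAt p' (p'' x) x)
    (hpos : ∀ x, 0 < p x) (hlog : ∀ x, p x * p'' x ≤ p' x ^ 2)
    (hg : ∀ x, HasDerivAt g (g' x) x) (hg' : Continuous g')
    (hmean : ∫ x in a..b, g x * p x = 0) :
    κ ^ 2 * ∫ x in a..b, g x ^ 2 * p x ≤ ∫ x in a..b, g' x ^ 2 * p x := by
  have hpc : Continuous p := continuous_iff_continuousAt.2 fun x => (hp x).continuousAt
  have hgc : Continuous g := continuous_iff_continuousAt.2 fun x => (hg x).continuousAt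
  set G : ℝ → ℝ := fun x => ∫ t in a..x, g t * p t with hG
  have hGd : ∀ x, HasDerivAt G (g x * p x) x := fun x =>
    (hgc.mul hpc).integral_hasStrictDerivAt a x |>.hasDerivAt
  have hGa : G a = 0 := by simp [hG]
  have hGb : G b = 0 := hmean
  set m := (a + b) / 2 with hm
  set c : ℝ → ℝ := fun x => -κ * Real.tan (κ * (x - m)) with hc
  have hcd : ∀ x ∈ Set.Icc a b, HasDerivAt c (-κ ^ 2 - c x ^ 2) x := by
    intro x hx
    have hcos : Real.cos (κ * (x - m)) ≠ 0 := by
      apply ne_of_gt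
      apply Real.cos_pos_of_mem_Ioo
      constructor <;> nlinarith [hx.1, hx.2]
    have h1 : HasDerivAt (fun x => κ * (x - m)) κ x := by
      simpa using ((hasDerivAt_id x).sub_const m).const_mul κ
    have h2 := ((Real.hasDerivAt_tan hcos).comp x h1).const_mul (-κ)
    refine HasDerivAt.congr_deriv h2 ?_
    simp only [hc, Real.tan_eq_sin_div_cos]
    field_simp
    nlinarith [Real.sin_sq_add_cos_sq (κ * (x - m))]
  set R : ℝ → ℝ := fun x =>
    κ ^ 2 * (G x ^ 2 / p x * (c x + p' x / (2 * p x)) - 2 * (g x * G x)) with hR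
  have hRd : ∀ x ∈ Set.Icc a b, HasDerivAt R
      (κ ^ 2 * ((2 * G x * (g x * p x) * p x - G x ^ 2 * p' x) / p x ^ 2
          * (c x + p' x / (2 * p x))
        + G x ^ 2 / p x * ((-κ ^ 2 - c x ^ 2)
          + (p'' x * (2 * p x) - p' x * (2 * p' x)) / (2 * p x) ^ 2)
        - 2 * (g' x * G x + g x * (g x * p x)))) x := by
    intro x hx
    have hx0 := (hpos x).ne'
    have h1 := ((hGd x).pow 2).div (hp x) hx0
    have h2 := (hp' x).div ((hp x).const_mul 2) (by positivity)
    have h3 := ((h1.mul ((hcd x hx).add h2)).sub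
      (((hg x).mul (hGd x)).const_mul 2)).const_mul (κ ^ 2)
    exact h3.congr_deriv (by simp)
  have key := intervalIntegral.sub_le_integral_of_hasDeriv_right_of_le hab
    (fun x hx => (hRd x hx).continuousAt.continuousWithinAt)
    (fun x hx => (hRd x ⟨hx.1.le, hx.2.le⟩).hasDerivWithinAt)
    (φ := fun x => g' x ^ 2 * p x - κ ^ 2 * (g x ^ 2 * p x))
    ((by fun_prop : Continuous _).integrableOn_Icc) ?_
  · rw [intervalIntegral.integral_sub, intervalIntegral.integral_const_mul] at key
    · simp only [hR, hGa, hGb] at key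
      simp at key
      exact key
    all_goals exact Continuous.intervalIntegrable (by fun_prop) _ _
  · intro x hx
    have hx0 := hpos x
    have e : (g' x ^ 2 * p x - κ ^ 2 * (g x ^ 2 * p x)) -
      (κ ^ 2 * ((2 * G x * (g x * p x) * p x - G x ^ 2 * p' x) / p x ^ 2
          * (c x + p' x / (2 * p x))
        + G x ^ 2 / p x * ((-κ ^ 2 - c x ^ 2)
          + (p'' x * (2 * p x) - p' x * (2 * p' x)) / (2 * p x) ^ 2)
        - 2 * (g' x * G x + g x * (g x * p x)))) =
      (g' x * p x + κ ^ 2 * G x) ^ 2 / p x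
      + κ ^ 2 * (p x * (g x - (c x + p' x / (2 * p x)) * G x / p x) ^ 2
        + G x ^ 2 / p x * ((p' x ^ 2 - p x * p'' x) / (2 * p x ^ 2)
          + p' x ^ 2 / (4 * p x ^ 2))) := by
      field_simp
      ring
    have h0 := sub_nonneg.2 (hlog x)
    rw [← sub_nonneg, e]
    positivity

theorem volume_add_volume_le_of_isCompact {A B C : Set ℝ} (hA : IsCompact A) (hB : IsCompact B)
    (hA0 : A.Nonempty) (hB0 : B.Nonempty) (hC : ∀ x ∈ A, ∀ y ∈ B, (x + y) / 2 ∈ C) :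
    volume A + volume B ≤ 2 * volume C := by
  obtain ⟨a, ha⟩ := hA.exists_isGreatest hA0
  obtain ⟨b, hb⟩ := hB.exists_isLeast hB0
  have hvol : ∀ (S : Set ℝ) (u : ℝ), volume S = 2 * volume ((fun z => z * 2 + -u) ⁻¹' S) := by
    intro S u
    have : (fun z : ℝ => z * 2 + -u) ⁻¹' S = (fun z => z * 2) ⁻¹' ((fun z => z + -u) ⁻¹' S) := rfl
    rw [this, Real.volume_preimage_mul_right two_ne_zero, measure_preimage_add_right, ← mul_assoc]
    have : (2 : ℝ≥0∞) * ENNReal.ofReal |2⁻¹| = 1 := by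
      rw [← ENNReal.ofReal_ofNat, ← ENNReal.ofReal_mul (by norm_num)]
      norm_num
    rw [this, one_mul]
  rw [hvol A b, hvol B a, ← mul_add]
  gcongr
  rw [← measure_union₀]
  · apply measure_mono
    rintro z (hz | hz)
    · have := hC _ hz _ hb.1
      simpa using this
    · have := hC _ ha.1 _ hz
      simpa using this
  · exact (hB.measurableSet.preimage (by fun_prop)).nullMeasurableSet
  · refine measure_mono_null (t := {(a + b) / 2}) ?_ (by simp)
    rintro z ⟨hz1, hz2⟩
    have h1 := ha.2 hz1
    have h2 := hb.2 hz2
    simp only [Set.mem_singleton_iff]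
    linarith

theorem volume_add_volume_le_of_measurableSet {A B C : Set ℝ} (hA : MeasurableSet A)
    (hB : MeasurableSet B) (hA0 : A.Nonempty) (hB0 : B.Nonempty)
    (hC : ∀ x ∈ A, ∀ y ∈ B, (x + y) / 2 ∈ C) :
    volume A + volume B ≤ 2 * volume C := by
  obtain ⟨a, ha⟩ := hA0
  obtain ⟨b, hb⟩ := hB0
  refine le_of_forall_lt fun r hr => ?_
  obtain ⟨u, v, hu, hv, hr⟩ : ∃ u v, (u < volume A ∨ u = 0) ∧ (v < volume B ∨ v = 0) ∧
      r < u + v := by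
    rcases eq_or_ne (volume A) 0 with hA0 | hA0
    · rw [hA0, zero_add] at hr
      obtain ⟨v, h1, h2⟩ := exists_between hr
      exact ⟨0, v, Or.inr rfl, Or.inl h2, by simpa⟩
    rcases eq_or_ne (volume B) 0 with hB0 | hB0
    · rw [hB0, add_zero] at hr
      obtain ⟨v, h1, h2⟩ := exists_between hr
      exact ⟨v, 0, Or.inl h2, Or.inr rfl, by simpa⟩
    obtain ⟨u, h1, v, h2, h3⟩ := ENNReal.exists_lt_add_of_lt_add hr hA0 hB0
    exact ⟨u, v, Or.inl h1, Or.inl h2, h3⟩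
  have aux : ∀ {S : Set ℝ} {s : ℝ} {w : ℝ≥0∞}, MeasurableSet S → s ∈ S →
      (w < volume S ∨ w = 0) → ∃ K ⊆ S, IsCompact K ∧ K.Nonempty ∧ w ≤ volume K := by
    rintro S s w hS hs (hw | rfl)
    · obtain ⟨K, h1, h2, h3⟩ := hS.exists_lt_isCompact hw
      refine ⟨K, h1, h2, ?_, h3.le⟩
      by_contra hne
      rw [Set.not_nonempty_iff_eq_empty] at hne
      simp [hne] at h3
    · exact ⟨{s}, by simpa, isCompact_singleton, Set.singleton_nonempty s, zero_le⟩
  obtain ⟨K, hK1, hK2, hK3, hK4⟩ := aux hA ha hu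
  obtain ⟨L, hL1, hL2, hL3, hL4⟩ := aux hB hb hv
  exact hr.trans_le ((add_le_add hK4 hL4).trans
    (volume_add_volume_le_of_isCompact hK2 hL2 hK3 hL3 fun x hx y hy => hC x (hK1 hx) y (hL1 hy)))

theorem lintegral_add_lintegral_le_of_sup_eq_one {f g h : ℝ → ℝ}
    (hf : Measurable f) (hg : Measurable g) (hh : Measurable h)
    (hf0 : 0 ≤ f) (hg0 : 0 ≤ g) (hh0 : 0 ≤ h) (hf1 : ∀ x, f x ≤ 1) (hg1 : ∀ x, g x ≤ 1)
    (hfs : ∀ t < 1, ∃ x, t < f x) (hgs : ∀ t < 1, ∃ x, t < g x)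
    (hfgh : ∀ x y, f x * g y ≤ h ((x + y) / 2) ^ 2) :
    (∫⁻ x, ENNReal.ofReal (f x)) + ∫⁻ x, ENNReal.ofReal (g x) ≤
      2 * ∫⁻ x, ENNReal.ofReal (h x) := by
  have hm : ∀ u : ℝ → ℝ, Measurable fun t : ℝ => volume {a | t < u a} := by
    intro u
    apply Antitone.measurable
    intro s t hst
    exact measure_mono fun x hx => lt_of_le_of_lt hst hx
  rw [lintegral_eq_lintegral_meas_lt volume (.of_forall hf0) hf.aemeasurable,
    lintegral_eq_lintegral_meas_lt volume (.of_forall hg0) hg.aemeasurable,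
    lintegral_eq_lintegral_meas_lt volume (.of_forall hh0) hh.aemeasurable,
    ← lintegral_add_left (hm f), ← lintegral_const_mul _ (hm h)]
  refine setLIntegral_mono ((hm h).const_mul _) fun t ht => ?_
  rcases lt_or_ge t 1 with ht1 | ht1
  · refine volume_add_volume_le_of_measurableSet (measurableSet_lt measurable_const hf)
      (measurableSet_lt measurable_const hg) (hfs t ht1) (hgs t ht1) ?_
    intro x hx y hy
    refine lt_of_pow_lt_pow_left₀ 2 (hh0 _) (lt_of_lt_of_le ?_ (hfgh x y))
    rw [sq]
    have ht0 : 0 < t := ht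
    exact mul_lt_mul'' hx hy ht0.le ht0.le
  · have h1 : {a | t < f a} = ∅ := by
      ext x; simpa using (hf1 x).trans ht1
    have h2 : {a | t < g a} = ∅ := by
      ext x; simpa using (hg1 x).trans ht1
    simp [h1, h2]

theorem ENNReal.four_mul_mul_le_add_sq (a b : ℝ≥0∞) : 4 * (a * b) ≤ (a + b) ^ 2 := by
  rcases eq_or_ne a ∞ with rfl | ha
  · simp
  rcases eq_or_ne b ∞ with rfl | hb
  · simp
  lift a to NNReal using ha
  lift b to NNReal using hb
  norm_cast
  rw [← NNReal.coe_le_coe]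
  push_cast
  nlinarith [sq_nonneg ((a : ℝ) - b)]

theorem prekopaLeindler_real_of_bounded {f g h : ℝ → ℝ≥0∞}
    (hf : Measurable f) (hg : Measurable g) (hh : Measurable h)
    {c : ℝ≥0∞} (hc : c ≠ ∞) (hfc : ∀ x, f x ≤ c) (hgc : ∀ x, g x ≤ c)
    (hfgh : ∀ x y, f x * g y ≤ h ((x + y) / 2) ^ 2) :
    (∫⁻ x, f x) * ∫⁻ x, g x ≤ (∫⁻ x, h x) ^ 2 := by
  obtain ⟨S, hS⟩ : ∃ S, S = ⨆ x, f x := ⟨_, rfl⟩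
  obtain ⟨T, hT⟩ : ∃ T, T = ⨆ x, g x := ⟨_, rfl⟩
  have hSf : ∀ x, f x ≤ S := fun x => hS ▸ le_iSup f x
  have hTg : ∀ x, g x ≤ T := fun x => hT ▸ le_iSup g x
  have hStop : S ≠ ∞ := ne_top_of_le_ne_top hc (hS ▸ iSup_le hfc)
  have hTtop : T ≠ ∞ := ne_top_of_le_ne_top hc (hT ▸ iSup_le hgc)
  rcases eq_or_ne S 0 with hS0 | hS0
  · have : ∀ x, f x = 0 := fun x => by simpa [hS0] using hSf x
    simp [this]
  rcases eq_or_ne T 0 with hT0 | hT0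
  · have : ∀ x, g x = 0 := fun x => by simpa [hT0] using hTg x
    simp [this]
  obtain ⟨R, hR⟩ : ∃ R : ℝ≥0∞, R ^ 2 = S * T :=
    ⟨(S * T) ^ (1 / 2 : ℝ), by rw [← ENNReal.rpow_natCast, ← ENNReal.rpow_mul]; norm_num⟩
  have hR0 : R ≠ 0 := by
    rintro rfl
    simp [hS0, hT0, eq_comm] at hR
  have hRtop : R ≠ ∞ := by
    rintro rfl
    have := (ENNReal.mul_lt_top hStop.lt_top hTtop.lt_top).ne
    simp [← hR] at this
  have hdiv : ∀ {u : ℝ → ℝ≥0∞} {U : ℝ≥0∞}, U ≠ 0 → U ≠ ∞ → (∀ x, u x ≤ U) → ∀ x, u x / U ≤ 1 :=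
    fun h0 htop hu x => ENNReal.div_le_of_le_mul (by simpa using hu x)
  have hsup : ∀ {u : ℝ → ℝ≥0∞} {U : ℝ≥0∞}, U ≠ 0 → U ≠ ∞ → U = ⨆ x, u x → ∀ t < (1 : ℝ),
      ∃ x, t < (u x / U).toReal := by
    intro u U h0 htop hU t ht
    rcases lt_or_ge t 0 with ht0 | ht0
    · exact ⟨0, ht0.trans_le ENNReal.toReal_nonneg⟩
    have hle : ∀ x, u x ≤ U := fun x => hU ▸ le_iSup u x
    have h1 : ENNReal.ofReal t * U < U := by
      conv_rhs => rw [← one_mul U]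
      exact ENNReal.mul_lt_mul_left h0 htop (by simpa using ht)
    rw [hU, lt_iSup_iff, ← hU] at h1
    obtain ⟨x, hx⟩ := h1
    refine ⟨x, ?_⟩
    rw [← ENNReal.ofReal_lt_iff_lt_toReal ht0
      (ne_top_of_le_ne_top ENNReal.one_ne_top (hdiv h0 htop hle x))]
    exact (ENNReal.lt_div_iff_mul_lt (.inl h0) (.inl htop)).2 hx
  have key := lintegral_add_lintegral_le_of_sup_eq_one
    (f := fun x => (f x / S).toReal) (g := fun x => (g x / T).toReal)
    (h := fun x => (min (h x / R) 1).toReal)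
    (hf.div_const S).ennreal_toReal (hg.div_const T).ennreal_toReal
    ((hh.div_const R).min measurable_const).ennreal_toReal
    (fun _ => ENNReal.toReal_nonneg) (fun _ => ENNReal.toReal_nonneg)
    (fun _ => ENNReal.toReal_nonneg)
    (fun x => ENNReal.toReal_le_of_le_ofReal zero_le_one (by simpa using hdiv hS0 hStop hSf x))
    (fun x => ENNReal.toReal_le_of_le_ofReal zero_le_one (by simpa using hdiv hT0 hTtop hTg x))
    (hsup hS0 hStop hS) (hsup hT0 hTtop hT) (by
      intro x y
      rw [← ENNReal.toReal_mul, ← ENNReal.toReal_pow]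
      apply ENNReal.toReal_mono
      · simp
      rcases min_choice (h ((x + y) / 2) / R) 1 with h1 | h1 <;> rw [h1]
      · rw [div_eq_mul_inv, div_eq_mul_inv, div_eq_mul_inv, mul_pow, mul_mul_mul_comm,
          ← ENNReal.inv_pow, hR, ENNReal.mul_inv (.inl hS0) (.inl hStop)]
        gcongr
        exact hfgh x y
      · rw [one_pow]
        exact mul_le_one' (hdiv hS0 hStop hSf x) (hdiv hT0 hTtop hTg y))
  have hfin : ∀ {u : ℝ → ℝ≥0∞} {U : ℝ≥0∞}, U ≠ 0 → U ≠ ∞ → Measurable u → (∀ x, u x ≤ U) →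
      ∫⁻ x, ENNReal.ofReal (u x / U).toReal = (∫⁻ x, u x) / U := by
    intro u U h0 htop hum hu
    rw [div_eq_mul_inv, ← lintegral_mul_const _ hum]
    refine lintegral_congr fun x => ?_
    rw [ENNReal.ofReal_toReal, div_eq_mul_inv]
    exact ne_top_of_le_ne_top ENNReal.one_ne_top (hdiv h0 htop hu x)
  rw [hfin hS0 hStop hf hSf, hfin hT0 hTtop hg hTg] at key
  have key2 : (∫⁻ x, f x) / S + (∫⁻ x, g x) / T ≤ 2 * ((∫⁻ x, h x) / R) := by
    refine key.trans ?_
    gcongr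
    rw [div_eq_mul_inv, ← lintegral_mul_const _ hh]
    refine lintegral_mono fun x => ?_
    exact ENNReal.ofReal_toReal_le.trans (min_le_left _ _)
  have key3 : 4 * ((∫⁻ x, f x) * ∫⁻ x, g x) / R ^ 2 ≤ 4 * (∫⁻ x, h x) ^ 2 / R ^ 2 := by
    calc 4 * ((∫⁻ x, f x) * ∫⁻ x, g x) / R ^ 2
        = 4 * ((∫⁻ x, f x) / S * ((∫⁻ x, g x) / T)) := by
          rw [hR]
          simp only [div_eq_mul_inv]
          rw [ENNReal.mul_inv (.inl hS0) (.inl hStop)]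
          ring
      _ ≤ _ := ENNReal.four_mul_mul_le_add_sq _ _
      _ ≤ (2 * ((∫⁻ x, h x) / R)) ^ 2 := by gcongr
      _ = _ := by
          simp only [div_eq_mul_inv]
          rw [ENNReal.inv_pow]
          ring
  rw [ENNReal.div_le_iff_le_mul (by simp [hR0]) (by simp [hRtop]),
    ENNReal.div_mul_cancel (by simp [hR0]) (by simp [hRtop])] at key3
  exact (ENNReal.mul_le_mul_iff_right (by simp) (by simp)).1 key3

/-- The one-dimensional Prékopa–Leindler inequality for midpoints. -/
theorem prekopaLeindler_real {f g h : ℝ → ℝ≥0∞}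
    (hf : Measurable f) (hg : Measurable g) (hh : Measurable h)
    (hfgh : ∀ x y, f x * g y ≤ h ((x + y) / 2) ^ 2) :
    (∫⁻ x, f x) * ∫⁻ x, g x ≤ (∫⁻ x, h x) ^ 2 := by
  have htrunc : ∀ {u : ℝ → ℝ≥0∞}, Measurable u →
      ∫⁻ x, u x = ⨆ n : ℕ, ∫⁻ x, min (u x) n := by
    intro u hu
    rw [← lintegral_iSup (fun n => hu.min measurable_const)]
    · refine lintegral_congr fun x => ?_
      rw [← inf_iSup_eq, ENNReal.iSup_natCast, inf_top_eq]
    · intro m n hmn x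
      dsimp only
      gcongr
  rw [htrunc hf, htrunc hg, ENNReal.iSup_mul]
  refine iSup_le fun m => ?_
  rw [ENNReal.mul_iSup]
  refine iSup_le fun n => ?_
  refine prekopaLeindler_real_of_bounded (c := max m n) (hf.min measurable_const)
    (hg.min measurable_const) hh (by simp) (fun x => (min_le_right _ _).trans (le_max_left _ _))
    (fun x => (min_le_right _ _).trans (le_max_right _ _)) fun x y => ?_
  exact (mul_le_mul' (min_le_left _ _) (min_le_left _ _)).trans (hfgh x y)

theorem prekopaLeindler_pi (n : ℕ) {f g h : (Fin n → ℝ) → ℝ≥0∞}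
    (hf : Measurable f) (hg : Measurable g) (hh : Measurable h)
    (hfgh : ∀ x y, f x * g y ≤ h ((1 / 2 : ℝ) • (x + y)) ^ 2) :
    (∫⁻ x, f x) * ∫⁻ x, g x ≤ (∫⁻ x, h x) ^ 2 := by
  induction n with
  | zero =>
    simp only [lintegral_unique]
    have h1 : (volume : Measure (Fin 0 → ℝ)) Set.univ = 1 := by
      rw [Measure.volume_pi_eq_dirac default]
      simp
    simp only [h1, mul_one]
    exact (hfgh _ _).trans_eq (congrArg (fun z => h z ^ 2) (Subsingleton.elim _ _))
  | succ n ih =>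
    have hmp := (volume_preserving_piFinSuccAbove (fun _ : Fin (n + 1) => ℝ) 0).symm
    have hsymm : ∀ q : ℝ × (Fin n → ℝ),
        (MeasurableEquiv.piFinSuccAbove (fun _ : Fin (n + 1) => ℝ) 0).symm q =
          Fin.cons q.1 q.2 := fun q => by
      simp [MeasurableEquiv.piFinSuccAbove, Fin.insertNthEquiv]
    have hint : ∀ {u : (Fin (n + 1) → ℝ) → ℝ≥0∞}, Measurable u →
        ∫⁻ x, u x = ∫⁻ s : ℝ, ∫⁻ z : Fin n → ℝ, u (Fin.cons s z) := by
      intro u hu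
      rw [← hmp.lintegral_comp hu, Measure.volume_eq_prod, lintegral_prod]
      · simp only [hsymm]
      · exact (hu.comp (MeasurableEquiv.measurable _)).aemeasurable
    have hcons : Measurable fun q : ℝ × (Fin n → ℝ) =>
        (Fin.cons q.1 q.2 : Fin (n + 1) → ℝ) := by
      simpa only [← hsymm] using
        (MeasurableEquiv.piFinSuccAbove (fun _ : Fin (n + 1) => ℝ) 0).symm.measurable
    have hmeas : ∀ {u : (Fin (n + 1) → ℝ) → ℝ≥0∞}, Measurable u →
        Measurable fun s : ℝ => ∫⁻ z : Fin n → ℝ, u (Fin.cons s z) :=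
      fun hu => (hu.comp hcons).lintegral_prod_right'
    rw [hint hf, hint hg, hint hh]
    refine prekopaLeindler_real (hmeas hf) (hmeas hg) (hmeas hh) fun s t => ?_
    have hc : ∀ s : ℝ, Measurable fun z : Fin n → ℝ => (Fin.cons s z : Fin (n + 1) → ℝ) :=
      fun s => hcons.comp (by fun_prop : Measurable fun z : Fin n → ℝ => (s, z))
    refine ih (hf.comp (hc s)) (hg.comp (hc t)) (hh.comp (hc _)) fun x y => ?_
    refine (hfgh _ _).trans_eq ?_
    congr 2
    ext i
    refine Fin.cases ?_ (fun j => ?_) i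
    · simp; ring
    · simp; ring

/-- The Prékopa–Leindler inequality for midpoints in Euclidean space. -/
theorem prekopaLeindler {d : ℕ} {f g h : EuclideanSpace ℝ (Fin d) → ℝ≥0∞}
    (hf : Measurable f) (hg : Measurable g) (hh : Measurable h)
    (hfgh : ∀ x y, f x * g y ≤ h ((1 / 2 : ℝ) • (x + y)) ^ 2) :
    (∫⁻ x, f x) * ∫⁻ x, g x ≤ (∫⁻ x, h x) ^ 2 := by
  have hmp := (EuclideanSpace.volume_preserving_symm_measurableEquiv_toLp (Fin d)).symm
  rw [← hmp.lintegral_comp hf, ← hmp.lintegral_comp hg, ← hmp.lintegral_comp hh]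
  exact prekopaLeindler_pi d (hf.comp (MeasurableEquiv.measurable _))
    (hg.comp (MeasurableEquiv.measurable _)) (hh.comp (MeasurableEquiv.measurable _))
    fun x y => hfgh _ _

theorem hasDerivAt_setIntegral_comp_sub {E : Type*} [TopologicalSpace E] [T2Space E]
    [MeasurableSpace E] [BorelSpace E] {μ : Measure E} [IsFiniteMeasureOnCompacts μ]
    {K : Set E} (hK : IsCompact K) {l : E → ℝ} (hl : Continuous l) {w w' : ℝ → ℝ}
    (hw : ∀ u, HasDerivAt w (w' u) u) (hw' : Continuous w') (s : ℝ) :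
    HasDerivAt (fun s => ∫ x in K, w (s - l x) ∂μ) (∫ x in K, w' (s - l x) ∂μ) s := by
  have hwc : Continuous w := continuous_iff_continuousAt.2 fun u => (hw u).continuousAt
  obtain ⟨C, hC⟩ := (((isCompact_Icc (a := s - 1) (b := s + 1)).prod hK).image
    (f := fun q : ℝ × E => q.1 - l q.2) (by fun_prop)).exists_bound_of_continuousOn
    hw'.continuousOn
  have hint : ∀ {v : ℝ → ℝ}, Continuous v → ∀ t, IntegrableOn (fun x => v (t - l x)) K μ :=
    fun hv t => ContinuousOn.integrableOn_compact hK
      (hv.comp (continuous_const.sub hl)).continuousOn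
  refine (hasDerivAt_integral_of_dominated_loc_of_deriv_le
    (Icc_mem_nhds (by linarith : s - 1 < s) (by linarith : s < s + 1))
    (.of_forall fun t => (hint hwc t).aestronglyMeasurable) (hint hwc s)
    (F' := fun t x => w' (t - l x)) (hint hw' s).aestronglyMeasurable
    (bound := fun _ => C) ?_ (integrableOn_const hK.measure_lt_top.ne) ?_).2
  · rw [ae_restrict_iff' hK.measurableSet]
    exact .of_forall fun x hx t ht => hC _ ⟨(t, x), ⟨ht, hx⟩, rfl⟩
  · refine .of_forall fun x t _ => ?_
    exact ((hw (t - l x)).comp t ((hasDerivAt_id t).sub_const (l x))).congr_deriv (by simp)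

theorem mul_deriv_deriv_le_sq_of_midpoint_logConcave {p p' p'' : ℝ → ℝ}
    (hp : ∀ x, HasDerivAt p (p' x) x) (hp' : ∀ x, HasDerivAt p' (p'' x) x)
    (hmid : ∀ s t, p (s + t) * p (s - t) ≤ p s ^ 2) (s : ℝ) :
    p s * p'' s ≤ p' s ^ 2 := by
  set F : ℝ → ℝ := fun t => p (s + t) * p (s - t) with hF
  have hplus : ∀ {v v' : ℝ → ℝ}, (∀ x, HasDerivAt v (v' x) x) → ∀ t,
      HasDerivAt (fun t => v (s + t)) (v' (s + t)) t := fun hv t => by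
    exact ((hv (s + t)).comp t ((hasDerivAt_id t).const_add s)).congr_deriv (by simp)
  have hminus : ∀ {v v' : ℝ → ℝ}, (∀ x, HasDerivAt v (v' x) x) → ∀ t,
      HasDerivAt (fun t => v (s - t)) (-v' (s - t)) t := fun hv t => by
    exact ((hv (s - t)).comp t ((hasDerivAt_id t).const_sub s)).congr_deriv (by simp)
  have hF1 : ∀ t, HasDerivAt F (p' (s + t) * p (s - t) + p (s + t) * -p' (s - t)) t :=
    fun t => (hplus hp t).mul (hminus hp t)
  have hF1' : deriv F = fun t => p' (s + t) * p (s - t) + p (s + t) * -p' (s - t) :=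
    funext fun t => (hF1 t).deriv
  have hF2 : deriv (deriv F) 0 = 2 * (p s * p'' s - p' s ^ 2) := by
    rw [hF1']
    have := ((hplus hp' 0).mul (hminus hp 0)).add ((hplus hp 0).mul (hminus hp' 0).neg)
    refine this.deriv.trans ?_
    simp only [add_zero, sub_zero, Pi.neg_apply]
    ring
  by_contra! hcon
  have hmax : IsLocalMax F 0 := .of_forall fun t => by
    simpa [hF, sq] using hmid s t
  have hmin : IsLocalMin F 0 := by
    refine isLocalMin_of_deriv_deriv_pos ?_ ?_ (hF1 0).continuousAt
    · rw [hF2]; linarith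
    · rw [hF1']; simp; ring
  have hconst : F =ᶠ[nhds 0] fun _ => F 0 := by
    filter_upwards [hmax, hmin] with t h1 h2 using le_antisymm h1 h2
  have h0 := hconst.deriv.deriv_eq
  simp only [deriv_const', deriv_const] at h0
  rw [hF2] at h0
  linarith

theorem setIntegral_comp_sub_mul_le {d : ℕ} {K : Set (EuclideanSpace ℝ (Fin d))}
    (hK : IsCompact K) (hKc : Convex ℝ K) (l : EuclideanSpace ℝ (Fin d) →L[ℝ] ℝ)
    {w : ℝ → ℝ} (hw : Continuous w) (hw0 : ∀ u, 0 ≤ w u)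
    (hmid : ∀ u v, w u * w v ≤ w ((u + v) / 2) ^ 2) (s t : ℝ) :
    (∫ x in K, w (s - l x)) * ∫ x in K, w (t - l x) ≤ (∫ x in K, w ((s + t) / 2 - l x)) ^ 2 := by
  have hint : ∀ t, ENNReal.ofReal (∫ x in K, w (t - l x)) =
      ∫⁻ x, K.indicator (fun x => ENNReal.ofReal (w (t - l x))) x := by
    intro t
    rw [lintegral_indicator hK.measurableSet, ofReal_integral_eq_lintegral_ofReal]
    · exact ContinuousOn.integrableOn_compact hK (by fun_prop)
    · exact .of_forall fun x => hw0 _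
  have hnn : ∀ t, 0 ≤ ∫ x in K, w (t - l x) := fun t => integral_nonneg fun x => hw0 _
  have hmeas : ∀ t : ℝ, Measurable (K.indicator fun x => ENNReal.ofReal (w (t - l x))) :=
    fun t => (ENNReal.measurable_ofReal.comp
      (by fun_prop : Continuous fun x => w (t - l x)).measurable).indicator hK.measurableSet
  have key := prekopaLeindler (hmeas s) (hmeas t) (hmeas ((s + t) / 2)) ?_
  · rw [← hint, ← hint, ← hint, ← ENNReal.ofReal_mul (hnn s), ← ENNReal.ofReal_pow (hnn _)] at key
    exact (ENNReal.ofReal_le_ofReal_iff (by positivity)).1 key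
  · intro x y
    by_cases hx : x ∈ K
    swap
    · simp [hx]
    by_cases hy : y ∈ K
    swap
    · simp [hy]
    have hxy : (1 / 2 : ℝ) • (x + y) ∈ K := by
      rw [smul_add]
      exact hKc hx hy (by norm_num) (by norm_num) (by norm_num)
    rw [Set.indicator_of_mem hx, Set.indicator_of_mem hy, Set.indicator_of_mem hxy,
      ← ENNReal.ofReal_mul (hw0 _), ← ENNReal.ofReal_pow (hw0 _)]
    refine ENNReal.ofReal_le_ofReal ((hmid _ _).trans_eq ?_)
    congr 2
    simp only [map_smul, map_add, smul_eq_mul]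
    ring

/-- The Gaussian density scaled by `c`. -/
noncomputable def gaussianKernel (c u : ℝ) : ℝ := c * (Real.exp (-1 * (c * u) ^ 2) / √Real.pi)

theorem continuous_gaussianKernel (c : ℝ) : Continuous (gaussianKernel c) := by
  unfold gaussianKernel
  fun_prop

theorem gaussianKernel_pos {c : ℝ} (hc : 0 < c) (u : ℝ) : 0 < gaussianKernel c u := by
  have := Real.pi_pos
  unfold gaussianKernel
  positivity

theorem hasDerivAt_gaussianKernel (c u : ℝ) :
    HasDerivAt (gaussianKernel c) (-2 * c ^ 2 * u * gaussianKernel c u) u := by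
  have h1 : HasDerivAt (fun u : ℝ => -1 * (c * u) ^ 2) (-1 * (2 * (c * u) * c)) u := by
    simpa using (((hasDerivAt_id u).const_mul c).pow 2).const_mul (-1)
  refine ((h1.exp.div_const (√Real.pi)).const_mul c).congr_deriv ?_
  unfold gaussianKernel
  ring

theorem gaussianKernel_mul_le (c u v : ℝ) :
    gaussianKernel c u * gaussianKernel c v ≤ gaussianKernel c ((u + v) / 2) ^ 2 := by
  unfold gaussianKernel
  have : Real.exp (-1 * (c * u) ^ 2) * Real.exp (-1 * (c * v) ^ 2) ≤
      Real.exp (-1 * (c * ((u + v) / 2)) ^ 2) ^ 2 := by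
    rw [← Real.exp_add, ← Real.exp_nat_mul]
    apply Real.exp_le_exp.2
    push_cast
    nlinarith [sq_nonneg (c * (u - v))]
  calc _ = (c / √Real.pi) ^ 2 *
        (Real.exp (-1 * (c * u) ^ 2) * Real.exp (-1 * (c * v) ^ 2)) := by ring
    _ ≤ (c / √Real.pi) ^ 2 * Real.exp (-1 * (c * ((u + v) / 2)) ^ 2) ^ 2 := by gcongr
    _ = _ := by ring

theorem gaussianKernel_eq (c y s : ℝ) :
    gaussianKernel c (s - y) = c / √Real.pi * Real.exp (-c ^ 2 * (s - y) ^ 2) := by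
  unfold gaussianKernel
  ring_nf

theorem integrable_gaussianKernel {c : ℝ} (hc : 0 < c) (y : ℝ) :
    Integrable fun s => gaussianKernel c (s - y) := by
  simp only [gaussianKernel_eq]
  exact ((integrable_exp_neg_mul_sq (by positivity)).comp_sub_right y).const_mul _

theorem integral_gaussianKernel {c : ℝ} (hc : 0 < c) (y : ℝ) :
    ∫ s, gaussianKernel c (s - y) = 1 := by
  simp only [gaussianKernel_eq]
  have := Real.pi_pos
  rw [integral_const_mul, integral_sub_right_eq_self (fun s => Real.exp (-c ^ 2 * s ^ 2)),
    integral_gaussian, Real.sqrt_div' _ (by positivity), Real.sqrt_sq hc.le]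
  field_simp

theorem tendsto_integral_gaussianKernel_mul {g : ℝ → ℝ} (hg : Integrable g) {y : ℝ}
    (hy : ContinuousAt g y) :
    Filter.Tendsto (fun c => ∫ s, gaussianKernel c (s - y) * g s) Filter.atTop (nhds (g y)) := by
  have hπ := Real.pi_pos
  have key := tendsto_integral_comp_smul_smul_of_integrable' (μ := volume)
    (φ := fun u : ℝ => Real.exp (-1 * u ^ 2) / √Real.pi) (fun x => by positivity) ?_ ?_ hg hy
  · refine key.congr fun c => integral_congr_ae (.of_forall fun s => ?_)
    simp only [Module.finrank_self, pow_one, smul_eq_mul, gaussianKernel]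
    rw [show (c * (y - s)) ^ 2 = (c * (s - y)) ^ 2 by ring]
  · rw [integral_div, integral_gaussian]
    rw [div_one, div_self (by positivity)]
  · rw [Metric.cobounded_eq_cocompact]
    have := (tendsto_rpow_abs_mul_exp_neg_mul_sq_cocompact (a := 1) one_pos 1).div_const
      (√Real.pi)
    simpa [mul_div_assoc] using this

theorem tendsto_intervalIntegral_mul_setIntegral_gaussianKernel {E : Type*} [TopologicalSpace E]
    [T2Space E] [MeasurableSpace E] [BorelSpace E] [SecondCountableTopology E] {μ : Measure E}
    [IsFiniteMeasureOnCompacts μ] [SFinite μ]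
    {K : Set E} (hK : IsCompact K) {l : E → ℝ} (hl : Continuous l) {a b : ℝ} (hab : a ≤ b)
    (hlK : ∀ x ∈ K, l x ∈ Set.Ioo a b) {g : ℝ → ℝ} (hg : Continuous g) :
    Filter.Tendsto (fun c => ∫ s in a..b, g s * ∫ x in K, gaussianKernel c (s - l x) ∂μ)
      Filter.atTop (nhds (∫ x in K, g (l x) ∂μ)) := by
  have hk := continuous_gaussianKernel
  obtain ⟨B, hB⟩ := (isCompact_Icc (a := a) (b := b)).exists_bound_of_continuousOn hg.continuousOn
  have hint : ∀ c, Integrable (Function.uncurry fun s x => gaussianKernel c (s - l x) * g s)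
      ((volume.restrict (Set.uIoc a b)).prod (μ.restrict K)) := by
    intro c
    rw [Measure.prod_restrict]
    refine IntegrableOn.mono_set (t := Set.Icc a b ×ˢ K) ?_ (Set.prod_mono_left ?_)
    · refine ContinuousOn.integrableOn_compact (isCompact_Icc.prod hK) ?_
      have := hk c
      unfold Function.uncurry
      fun_prop
    · rw [Set.uIoc_of_le hab]
      exact Set.Ioc_subset_Icc_self
  have hswap : ∀ c, ∫ s in a..b, g s * ∫ x in K, gaussianKernel c (s - l x) ∂μ =
      ∫ x in K, (∫ s in a..b, gaussianKernel c (s - l x) * g s) ∂μ := by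
    intro c
    rw [← intervalIntegral_integral_swap (hint c)]
    refine intervalIntegral.integral_congr fun s _ => ?_
    simp only [integral_mul_const]
    ring
  simp_rw [hswap]
  refine tendsto_integral_filter_of_dominated_convergence (fun _ => B) ?_ ?_
    (integrableOn_const hK.measure_lt_top.ne) ?_
  · refine .of_forall fun c => ?_
    have := (hint c).integral_prod_right.aestronglyMeasurable
    refine this.congr (.of_forall fun x => ?_)
    simp [intervalIntegral.intervalIntegral_eq_integral_uIoc, hab]
  · filter_upwards [Filter.eventually_gt_atTop 0] with c hc
    refine .of_forall fun x => ?_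
    have hi : IntegrableOn (fun s => gaussianKernel c (s - l x) * B) (Set.Ioc a b) :=
      ((integrable_gaussianKernel hc _).mul_const B).integrableOn
    rw [intervalIntegral.integral_of_le hab]
    refine (norm_integral_le_of_norm_le hi ?_).trans ?_
    · rw [ae_restrict_iff' measurableSet_Ioc]
      refine .of_forall fun s hs => ?_
      rw [norm_mul, Real.norm_of_nonneg (gaussianKernel_pos hc _).le]
      exact mul_le_mul_of_nonneg_left (hB s (Set.Ioc_subset_Icc_self hs))
        (gaussianKernel_pos hc _).le
    · have hB0 : 0 ≤ B := (norm_nonneg _).trans (hB a ⟨le_rfl, hab⟩)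
      calc _ ≤ ∫ s, gaussianKernel c (s - l x) * B :=
            setIntegral_le_integral ((integrable_gaussianKernel hc _).mul_const B)
              (.of_forall fun s => mul_nonneg (gaussianKernel_pos hc _).le hB0)
        _ = B := by rw [integral_mul_const, integral_gaussianKernel hc, one_mul]
  · rw [ae_restrict_iff' hK.measurableSet]
    refine .of_forall fun x hx => ?_
    have hnhds : Set.Ioc a b ∈ nhds (l x) :=
      Filter.mem_of_superset (isOpen_Ioo.mem_nhds (hlK x hx)) Set.Ioo_subset_Ioc_self
    have key := tendsto_integral_gaussianKernel_mul (g := (Set.Ioc a b).indicator g) (y := l x)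
      ((integrable_indicator_iff measurableSet_Ioc).2
        (hg.integrableOn_Icc.mono_set Set.Ioc_subset_Icc_self))
      (hg.continuousAt.congr (by
        filter_upwards [hnhds] with s hs using (Set.indicator_of_mem hs g).symm))
    rw [Set.indicator_of_mem (mem_of_mem_nhds hnhds)] at key
    refine key.congr fun c => ?_
    rw [intervalIntegral.integral_of_le hab, ← integral_indicator measurableSet_Ioc]
    refine integral_congr_ae (.of_forall fun s => ?_)
    by_cases hs : s ∈ Set.Ioc a b <;> simp [hs]

theorem wirtinger_variance_of_logConcave_weight {a b κ : ℝ} (hab : a < b) (hκ : 0 < κ)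
    (hκab : κ * (b - a) < Real.pi) {p p' p'' g g' : ℝ → ℝ}
    (hp : ∀ x, HasDerivAt p (p' x) x) (hp' : ∀ x, HasDerivAt p' (p'' x) x)
    (hpos : ∀ x, 0 < p x) (hlog : ∀ x, p x * p'' x ≤ p' x ^ 2)
    (hg : ∀ x, HasDerivAt g (g' x) x) (hg' : Continuous g') :
    κ ^ 2 * ((∫ x in a..b, 1 * p x) * (∫ x in a..b, g x ^ 2 * p x)
        - (∫ x in a..b, g x * p x) ^ 2) ≤
      (∫ x in a..b, 1 * p x) * ∫ x in a..b, g' x ^ 2 * p x := by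
  have hpc : Continuous p := continuous_iff_continuousAt.2 fun x => (hp x).continuousAt
  have hgc : Continuous g := continuous_iff_continuousAt.2 fun x => (hg x).continuousAt
  have hi : ∀ {u : ℝ → ℝ}, Continuous u → IntervalIntegrable u volume a b :=
    fun hu => hu.intervalIntegrable _ _
  simp only [one_mul]
  set M := ∫ x in a..b, p x
  set m := ∫ x in a..b, g x * p x
  have hM : 0 < M := intervalIntegral.intervalIntegral_pos_of_pos (hi hpc) hpos hab
  have key := wirtinger_of_logConcave_weight hab.le hκ hκab hp hp' hpos hlog
    (g := fun x => g x - m / M) (fun x => (hg x).sub_const _) hg' (by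
      simp only [sub_mul]
      rw [intervalIntegral.integral_sub (hi (by fun_prop)) (hi (by fun_prop)),
        intervalIntegral.integral_const_mul, div_mul_cancel₀ _ hM.ne', sub_self])
  have hexp : ∫ x in a..b, (g x - m / M) ^ 2 * p x =
      (∫ x in a..b, g x ^ 2 * p x) - m ^ 2 / M := by
    have : ∀ x, (g x - m / M) ^ 2 * p x =
        g x ^ 2 * p x - 2 * (m / M) * (g x * p x) + (m / M) ^ 2 * p x := fun x => by ring
    simp only [this]
    rw [intervalIntegral.integral_add (hi (by fun_prop)) (hi (by fun_prop)),
      intervalIntegral.integral_sub (hi (by fun_prop)) (hi (by fun_prop)),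
      intervalIntegral.integral_const_mul, intervalIntegral.integral_const_mul]
    field_simp
    ring
  rw [hexp] at key
  have := mul_le_mul_of_nonneg_left key hM.le
  calc _ = M * (κ ^ 2 * ((∫ x in a..b, g x ^ 2 * p x) - m ^ 2 / M)) := by field_simp
    _ ≤ _ := this

/-- The variance of a function of one linear coordinate on a convex body is controlled with the
one-dimensional Wirtinger constant. -/
theorem wirtinger_variance_comp_linear {d : ℕ} {K : Set (EuclideanSpace ℝ (Fin d))}
    (hK : IsCompact K) (hKc : Convex ℝ K) (l : EuclideanSpace ℝ (Fin d) →L[ℝ] ℝ)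
    {a b κ : ℝ} (hab : a ≤ b) (hκ : 0 < κ) (hκab : κ * (b - a) < Real.pi)
    (hlK : ∀ x ∈ K, l x ∈ Set.Icc a b) {g g' : ℝ → ℝ}
    (hg : ∀ x, HasDerivAt g (g' x) x) (hg' : Continuous g') :
    κ ^ 2 * (volume.real K * (∫ x in K, g (l x) ^ 2) - (∫ x in K, g (l x)) ^ 2) ≤
      volume.real K * ∫ x in K, g' (l x) ^ 2 := by
  rcases eq_or_ne (volume K) 0 with hK0 | hK0
  · simp [Measure.restrict_eq_zero.2 hK0, measureReal_def, hK0]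
  have hgc : Continuous g := continuous_iff_continuousAt.2 fun x => (hg x).continuousAt
  obtain ⟨δ, hδ0, hδ⟩ : ∃ δ > 0, κ * ((b + δ) - (a - δ)) < Real.pi := by
    refine ⟨(Real.pi - κ * (b - a)) / (4 * κ), div_pos (by linarith) (by positivity), ?_⟩
    field_simp
    linarith
  have hab' : a - δ < b + δ := by linarith
  have hlK' : ∀ x ∈ K, l x ∈ Set.Ioo (a - δ) (b + δ) := fun x hx =>
    ⟨by linarith [(hlK x hx).1], by linarith [(hlK x hx).2]⟩
  have hlim := fun {u : ℝ → ℝ} (hu : Continuous u) =>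
    tendsto_intervalIntegral_mul_setIntegral_gaussianKernel (μ := volume) hK l.continuous
      hab'.le hlK' hu
  have h1 := hlim (continuous_const (y := (1 : ℝ)))
  have hM : ∫ _x in K, (1 : ℝ) = volume.real K := by simp
  rw [hM] at h1
  have h2 := hlim (hgc.pow 2)
  have h3 := hlim hgc
  have h4 := hlim (hg'.pow 2)
  refine le_of_tendsto_of_tendsto (((h1.mul h2).sub (h3.pow 2)).const_mul (κ ^ 2)) (h1.mul h4) ?_
  filter_upwards [Filter.eventually_gt_atTop 0] with c hc
  have hk := continuous_gaussianKernel c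
  have hk' : ∀ u, HasDerivAt (fun u => -2 * c ^ 2 * u * gaussianKernel c u)
      (-2 * c ^ 2 * gaussianKernel c u
        + -2 * c ^ 2 * u * (-2 * c ^ 2 * u * gaussianKernel c u)) u := fun u => by
    have := ((hasDerivAt_id u).const_mul (-2 * c ^ 2)).mul (hasDerivAt_gaussianKernel c u)
    exact this.congr_deriv (by simp)
  have hp := hasDerivAt_setIntegral_comp_sub (μ := volume) hK l.continuous
    (hasDerivAt_gaussianKernel c) (by fun_prop)
  have hp' := hasDerivAt_setIntegral_comp_sub (μ := volume) hK l.continuous hk' (by fun_prop)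
  refine wirtinger_variance_of_logConcave_weight hab' hκ hδ hp hp' (fun s => ?_) ?_ hg hg'
  · have hpos : ∀ x, 0 < gaussianKernel c (s - l x) := fun x => gaussianKernel_pos hc _
    rw [setIntegral_pos_iff_support_of_nonneg_ae (.of_forall fun x => (hpos x).le)
      (ContinuousOn.integrableOn_compact hK (by fun_prop)),
      Function.support_eq_univ fun x => (hpos x).ne', Set.univ_inter]
    exact hK0.bot_lt
  · refine mul_deriv_deriv_le_sq_of_midpoint_logConcave hp hp' fun s t => ?_
    have := setIntegral_comp_sub_mul_le hK hKc l hk (fun u => (gaussianKernel_pos hc u).le)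
      (gaussianKernel_mul_le c) (s + t) (s - t)
    rwa [show (s + t + (s - t)) / 2 = s by ring] at this

theorem addHaar_level_eq_zero {E : Type*} [NormedAddCommGroup E] [NormedSpace ℝ E]
    [MeasurableSpace E] [BorelSpace E] [FiniteDimensional ℝ E] (μ : Measure E)
    [μ.IsAddHaarMeasure] {l : E →L[ℝ] ℝ} (hl : l ≠ 0) (t : ℝ) : μ {x | l x = t} = 0 := by
  by_cases h : ∃ x₀, l x₀ = t
  · obtain ⟨x₀, rfl⟩ := h
    have : {x | l x = l x₀} = (fun x => x + -x₀) ⁻¹' (LinearMap.ker l.toLinearMap : Set E) := by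
      ext x
      simp [← sub_eq_add_neg, sub_eq_zero]
    rw [this, measure_preimage_add_right]
    refine Measure.addHaar_submodule μ _ fun htop => hl ?_
    ext x
    simpa using LinearMap.congr_fun (LinearMap.ker_eq_top.1 htop) x
  · push Not at h
    simp [h]

/-- A signed mass which vanishes on a compact set can be bisected by a hyperplane of a prescribed
pencil, in such a way that a second mass remains positive on one of the two halves. -/
theorem exists_bisecting_halfspace {E : Type*} [NormedAddCommGroup E] [NormedSpace ℝ E]
    [MeasurableSpace E] [BorelSpace E] [FiniteDimensional ℝ E] {μ : Measure E}
    [μ.IsAddHaarMeasure] {K : Set E} (hK : IsCompact K) {φ ψ : E → ℝ}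
    (hφ : Continuous φ) (hψ : Continuous ψ) (hφ0 : ∫ x in K, φ x ∂μ = 0)
    (hψ0 : 0 < ∫ x in K, ψ x ∂μ) {l₁ l₂ : E →L[ℝ] ℝ}
    (hl : ∀ c s : ℝ, c • l₁ + s • l₂ = 0 → c = 0 ∧ s = 0) (α β : ℝ) :
    ∃ c s : ℝ, ¬(c = 0 ∧ s = 0) ∧
      ∫ x in K ∩ {x | 0 ≤ c * (l₁ x - α) + s * (l₂ x - β)}, φ x ∂μ = 0 ∧
      0 < ∫ x in K ∩ {x | 0 ≤ c * (l₁ x - α) + s * (l₂ x - β)}, ψ x ∂μ := by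
  set A : ℝ → E → ℝ := fun θ x => Real.cos θ * (l₁ x - α) + Real.sin θ * (l₂ x - β) with hA
  have htrig : ∀ θ, ¬(Real.cos θ = 0 ∧ Real.sin θ = 0) := fun θ h => by
    have := Real.sin_sq_add_cos_sq θ
    simp [h.1, h.2] at this
  have hnull : ∀ θ, μ {x | A θ x = 0} = 0 := by
    intro θ
    have h0 : Real.cos θ • l₁ + Real.sin θ • l₂ ≠ 0 := fun h => htrig θ (hl _ _ h)
    have hset : {x | A θ x = 0} = {x | (Real.cos θ • l₁ + Real.sin θ • l₂) x =
        Real.cos θ * α + Real.sin θ * β} := by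
      ext x
      change Real.cos θ * (l₁ x - α) + Real.sin θ * (l₂ x - β) = 0 ↔
        Real.cos θ * l₁ x + Real.sin θ * l₂ x = Real.cos θ * α + Real.sin θ * β
      constructor <;> intro h <;> linarith
    rw [hset]
    exact addHaar_level_eq_zero μ h0 _
  have hAπ : ∀ θ x, A (θ + Real.pi) x = -A θ x := fun θ x => by
    simp only [hA, Real.cos_add_pi, Real.sin_add_pi]
    ring
  have hAc : ∀ θ, Continuous (A θ) := fun θ => by
    simp only [hA]
    fun_prop
  have hAm : ∀ θ, MeasurableSet {x | 0 ≤ A θ x} := fun θ =>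
    (isClosed_le continuous_const (hAc θ)).measurableSet
  have hint : ∀ {f : E → ℝ}, Continuous f → IntegrableOn f K μ :=
    fun hf => hf.continuousOn.integrableOn_compact hK
  have hsplit : ∀ {f : E → ℝ}, Continuous f → ∀ θ,
      (∫ x in K ∩ {x | 0 ≤ A θ x}, f x ∂μ) + ∫ x in K ∩ {x | 0 ≤ A (θ + Real.pi) x}, f x ∂μ =
        ∫ x in K, f x ∂μ := by
    intro f hf θ
    rw [← integral_inter_add_sdiff (hAm θ) (hint hf)]
    congr 1
    refine setIntegral_congr_set ?_
    have : ∀ᵐ x ∂μ, A θ x ≠ 0 := by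
      rw [ae_iff]
      simpa using hnull θ
    filter_upwards [this] with x hx
    apply propext
    change (x ∈ K ∧ 0 ≤ A (θ + Real.pi) x) ↔ (x ∈ K ∧ ¬ 0 ≤ A θ x)
    rw [hAπ]
    refine and_congr_right fun _ => ?_
    rw [not_le]
    exact ⟨fun h => lt_of_le_of_ne (by linarith) hx, fun h => by linarith⟩
  have hcont : Continuous fun θ => ∫ x in K ∩ {x | 0 ≤ A θ x}, φ x ∂μ := by
    have : (fun θ => ∫ x in K ∩ {x | 0 ≤ A θ x}, φ x ∂μ) =
        fun θ => ∫ x in K, {x | 0 ≤ A θ x}.indicator φ x ∂μ := by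
      ext θ
      rw [setIntegral_indicator (hAm θ)]
    rw [this, continuous_iff_continuousAt]
    intro θ₀
    refine continuousAt_of_dominated (bound := fun x => ‖φ x‖)
      (.of_forall fun θ => ((hint hφ).indicator (hAm θ)).aestronglyMeasurable)
      (.of_forall fun θ => .of_forall fun x => norm_indicator_le_norm_self _ _)
      (hint hφ).norm ?_
    have hae : ∀ᵐ x ∂μ, A θ₀ x ≠ 0 := by
      rw [ae_iff]
      simpa using hnull θ₀
    filter_upwards [ae_restrict_of_ae hae] with x hx
    have hc : ContinuousAt (fun θ => A θ x) θ₀ := by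
      simp only [hA]
      fun_prop
    rcases hx.lt_or_gt with hx | hx
    · refine (continuousAt_const (y := (0 : ℝ))).congr ?_
      filter_upwards [hc.eventually_lt continuousAt_const hx] with θ hθ
      exact (Set.indicator_of_notMem (s := {x | 0 ≤ A θ x}) (not_le.2 hθ) φ).symm
    · refine (continuousAt_const (y := φ x)).congr ?_
      filter_upwards [continuousAt_const.eventually_lt hc hx] with θ hθ
      exact (Set.indicator_of_mem (s := {x | 0 ≤ A θ x}) hθ.le φ).symm
  obtain ⟨θ, hθ⟩ : (0 : ℝ) ∈ Set.range fun θ => ∫ x in K ∩ {x | 0 ≤ A θ x}, φ x ∂μ := by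
    have h0 := hsplit hφ 0
    rw [hφ0] at h0
    rcases le_total (∫ x in K ∩ {x | 0 ≤ A 0 x}, φ x ∂μ) 0 with h | h
    · exact mem_range_of_exists_le_of_exists_ge hcont ⟨0, h⟩ ⟨0 + Real.pi, by linarith⟩
    · exact mem_range_of_exists_le_of_exists_ge hcont ⟨0 + Real.pi, by linarith⟩ ⟨0, h⟩
  dsimp only at hθ
  have h1 := hsplit hφ θ
  have h2 := hsplit hψ θ
  by_cases h : 0 < ∫ x in K ∩ {x | 0 ≤ A θ x}, ψ x ∂μ
  · exact ⟨_, _, htrig θ, hθ, h⟩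
  · exact ⟨_, _, htrig (θ + Real.pi), by linarith, by linarith⟩

theorem exists_antitone_seq_forall_exists {α ι : Type*} [Preorder α] [Countable ι]
    {Q : ι → α → Prop} (h : ∀ i a, ∃ b ≤ a, Q i b) (a : α) :
    ∃ u : ℕ → α, Antitone u ∧ u 0 = a ∧ ∀ i, ∃ n, Q i (u n) := by
  rcases isEmpty_or_nonempty ι with hι | hι
  · exact ⟨fun _ => a, antitone_const, rfl, isEmptyElim⟩
  obtain ⟨e, he⟩ := exists_surjective_nat ι
  choose next hle hQ using h
  set u : ℕ → α := fun n => n.rec a fun n b => next (e n) b with hu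
  refine ⟨u, antitone_nat_of_succ_le fun n => hle (e n) (u n), rfl, fun i => ?_⟩
  obtain ⟨n, rfl⟩ := he i
  exact ⟨n + 1, hQ (e n) (u n)⟩

/-- A set which does not cross any line of a rational pencil in the `i, j`-coordinate plane has
one-dimensional projection to that plane. -/
theorem mul_eq_mul_of_rational_halfspaces {d : ℕ} {L : Set (EuclideanSpace ℝ (Fin d))}
    {i j : Fin d} (hL : ∀ α β : ℚ, ∃ c s : ℝ, ¬(c = 0 ∧ s = 0) ∧
      ∀ x ∈ L, 0 ≤ c * (x i - α) + s * (x j - β))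
    {x y z : EuclideanSpace ℝ (Fin d)} (hx : x ∈ L) (hy : y ∈ L) (hz : z ∈ L) :
    (y i - x i) * (z j - x j) = (y j - x j) * (z i - x i) := by
  by_contra hne
  set D := (y i - x i) * (z j - x j) - (y j - x j) * (z i - x i) with hD
  have hD0 : D ≠ 0 := sub_ne_zero.2 hne
  set S : ℝ × ℝ → ℝ := fun q => ((q.1 - x i) * (z j - x j) - (q.2 - x j) * (z i - x i)) / D with hS
  set T : ℝ × ℝ → ℝ := fun q => ((y i - x i) * (q.2 - x j) - (y j - x j) * (q.1 - x i)) / D with hT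
  have hSc : Continuous S := by simp only [hS]; fun_prop
  have hTc : Continuous T := by simp only [hT]; fun_prop
  obtain ⟨⟨α, β⟩, h1, h2, h3⟩ := ((Rat.denseRange_cast (𝕜 := ℝ)).prodMap
    (Rat.denseRange_cast (𝕜 := ℝ))).exists_mem_open
    (s := {q | 0 < S q} ∩ ({q | 0 < T q} ∩ {q | S q + T q < 1}))
    ((isOpen_lt continuous_const hSc).inter ((isOpen_lt continuous_const hTc).inter
      (isOpen_lt (hSc.add hTc) continuous_const)))
    ⟨((x i + y i + z i) / 3, (x j + y j + z j) / 3), by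
      have e1 : S ((x i + y i + z i) / 3, (x j + y j + z j) / 3) = 1 / 3 := by
        simp only [hS]
        rw [div_eq_iff hD0, hD]
        ring
      have e2 : T ((x i + y i + z i) / 3, (x j + y j + z j) / 3) = 1 / 3 := by
        simp only [hT]
        rw [div_eq_iff hD0, hD]
        ring
      simp only [Set.mem_inter_iff, Set.mem_ofPred_eq, e1, e2]
      norm_num⟩
  simp only [Prod.map_apply, Set.mem_ofPred_eq] at h1 h2 h3
  obtain ⟨c, s, hcs, hpos⟩ := hL α β
  have e1 : (α : ℝ) - x i = S (α, β) * (y i - x i) + T (α, β) * (z i - x i) := by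
    simp only [hS, hT]
    field_simp
    rw [hD]
    ring
  have e2 : (β : ℝ) - x j = S (α, β) * (y j - x j) + T (α, β) * (z j - x j) := by
    simp only [hS, hT]
    field_simp
    rw [hD]
    ring
  generalize S (α, β) = a at *
  generalize T (α, β) = b at *
  have px := hpos x hx
  have py := hpos y hy
  have pz := hpos z hz
  have hsum : (1 - a - b) * (c * (x i - α) + s * (x j - β)) +
      (a * (c * (y i - α) + s * (y j - β)) + b * (c * (z i - α) + s * (z j - β))) = 0 := by
    linear_combination (-c) * e1 - s * e2
  have m1 := mul_nonneg (by linarith : 0 ≤ 1 - a - b) px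
  have m2 := mul_nonneg h1.le py
  have m3 := mul_nonneg h2.le pz
  have zx := (mul_eq_zero.1 (by linarith : (1 - a - b) * (c * (x i - α) + s * (x j - β)) = 0)
    ).resolve_left (by linarith)
  have zy := (mul_eq_zero.1 (by linarith : a * (c * (y i - α) + s * (y j - β)) = 0)
    ).resolve_left h1.ne'
  have zz := (mul_eq_zero.1 (by linarith : b * (c * (z i - α) + s * (z j - β)) = 0)
    ).resolve_left h2.ne'
  refine hcs ⟨(mul_eq_zero.1 (?_ : c * D = 0)).resolve_right hD0,
    (mul_eq_zero.1 (?_ : s * D = 0)).resolve_right hD0⟩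
  · rw [hD]
    linear_combination (z j - x j) * (zy - zx) - (y j - x j) * (zz - zx)
  · rw [hD]
    linear_combination (y i - x i) * (zz - zx) - (z i - x i) * (zy - zx)

theorem exists_direction_of_mul_eq_mul {d : ℕ} {L : Set (EuclideanSpace ℝ (Fin d))}
    (hL0 : L.Nonempty) (hL : ∀ x ∈ L, ∀ y ∈ L, ∀ z ∈ L, ∀ i j,
      (y i - x i) * (z j - x j) = (y j - x j) * (z i - x i)) :
    ∃ x₀ e : EuclideanSpace ℝ (Fin d), ‖e‖ ≤ 1 ∧
      ∀ z ∈ L, x₀ + (inner ℝ e z - inner ℝ e x₀) • e = z := by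
  obtain ⟨x, hx⟩ := hL0
  by_cases hsub : ∃ y ∈ L, y ≠ x
  · obtain ⟨y, hy, hyx⟩ := hsub
    have hn : ‖y - x‖ ≠ 0 := norm_ne_zero_iff.2 (sub_ne_zero.2 hyx)
    refine ⟨x, ‖y - x‖⁻¹ • (y - x), ?_, fun z hz => ?_⟩
    · rw [norm_smul, norm_inv, norm_norm, inv_mul_cancel₀ hn]
    · have key : inner ℝ (y - x) (z - x) • (y - x) = ‖y - x‖ ^ 2 • (z - x) := by
        ext j
        rw [← real_inner_self_eq_norm_sq]
        simp only [PiLp.inner_apply, PiLp.smul_apply, PiLp.sub_apply, smul_eq_mul,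
          Finset.sum_mul]
        refine Finset.sum_congr rfl fun i _ => ?_
        simp only [RCLike.inner_apply, conj_trivial]
        linear_combination (y i - x i) * -(hL x hx y hy z hz i j)
      rw [← inner_sub_right, inner_smul_left, smul_smul]
      simp only [conj_trivial]
      rw [show ‖y - x‖⁻¹ * inner ℝ (y - x) (z - x) * ‖y - x‖⁻¹ =
        (‖y - x‖ ^ 2)⁻¹ * inner ℝ (y - x) (z - x) by field_simp, mul_smul, key, smul_smul,
        inv_mul_cancel₀ (pow_ne_zero 2 hn), one_smul, add_sub_cancel]
  · push Not at hsub
    exact ⟨x, 0, by simp, fun z hz => by simp [hsub z hz]⟩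

/-- Localization: balanced masses on a compact convex set can be pushed onto convex sets that
shrink to a segment. -/
theorem exists_needle {d : ℕ} {K : Set (EuclideanSpace ℝ (Fin d))} (hK : IsCompact K)
    (hKc : Convex ℝ K) {φ ψ : EuclideanSpace ℝ (Fin d) → ℝ} (hφ : Continuous φ)
    (hψ : Continuous ψ) (hφ0 : ∫ x in K, φ x = 0) (hψ0 : 0 < ∫ x in K, ψ x) :
    ∃ (u : ℕ → Set (EuclideanSpace ℝ (Fin d))) (x₀ e : EuclideanSpace ℝ (Fin d)),
      Antitone u ∧ (∀ n, IsCompact (u n) ∧ Convex ℝ (u n) ∧ u n ⊆ K ∧ ∫ x in u n, φ x = 0 ∧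
        0 < ∫ x in u n, ψ x) ∧ ‖e‖ ≤ 1 ∧
      ∀ z ∈ ⋂ n, u n, x₀ + (inner ℝ e z - inner ℝ e x₀) • e = z := by
  let α := {A : Set (EuclideanSpace ℝ (Fin d)) // IsCompact A ∧ Convex ℝ A ∧ A ⊆ K ∧
    ∫ x in A, φ x = 0 ∧ 0 < ∫ x in A, ψ x}
  let ι := {p : Fin d × Fin d // p.1 ≠ p.2} × ℚ × ℚ
  let Q : ι → α → Prop := fun p A => ∃ c s : ℝ, ¬(c = 0 ∧ s = 0) ∧
    ∀ x ∈ A.1, 0 ≤ c * (x p.1.1.1 - p.2.1) + s * (x p.1.1.2 - p.2.2)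
  have hstep : ∀ (p : ι) (A : α), ∃ B ≤ A, Q p B := by
    rintro ⟨⟨⟨i, j⟩, hij⟩, a, b⟩ ⟨A, hA, hAc, hAK, hA0, hA1⟩
    have hl : ∀ c s : ℝ, c • (EuclideanSpace.proj i : EuclideanSpace ℝ (Fin d) →L[ℝ] ℝ) +
        s • (EuclideanSpace.proj j : EuclideanSpace ℝ (Fin d) →L[ℝ] ℝ) = 0 → c = 0 ∧ s = 0 := by
      intro c s h
      have h1 := congrArg (fun l : EuclideanSpace ℝ (Fin d) →L[ℝ] ℝ =>
        l (EuclideanSpace.single i 1)) h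
      have h2 := congrArg (fun l : EuclideanSpace ℝ (Fin d) →L[ℝ] ℝ =>
        l (EuclideanSpace.single j 1)) h
      dsimp only at hij
      simp [hij] at h1
      simp [hij.symm] at h2
      exact ⟨h1, h2⟩
    obtain ⟨c, s, hcs, hB0, hB1⟩ := exists_bisecting_halfspace hA hφ hψ hA0 hA1 hl a b
    have hcl : IsClosed {x : EuclideanSpace ℝ (Fin d) | 0 ≤ c * (x i - a) + s * (x j - b)} :=
      isClosed_le continuous_const (by fun_prop)
    have hcv : Convex ℝ {x : EuclideanSpace ℝ (Fin d) | 0 ≤ c * (x i - a) + s * (x j - b)} := by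
      intro x hx y hy t r ht hr htr
      change 0 ≤ c * ((t • x + r • y) i - a) + s * ((t • x + r • y) j - b)
      have e : c * ((t • x + r • y) i - a) + s * ((t • x + r • y) j - b) =
          t * (c * (x i - a) + s * (x j - b)) + r * (c * (y i - a) + s * (y j - b)) := by
        simp only [PiLp.add_apply, PiLp.smul_apply, smul_eq_mul]
        linear_combination (c * a + s * b) * htr
      rw [e]
      exact add_nonneg (mul_nonneg ht hx) (mul_nonneg hr hy)
    exact ⟨⟨_, hA.inter_right hcl, hAc.inter hcv, Set.inter_subset_left.trans hAK, hB0, hB1⟩,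
      Set.inter_subset_left, c, s, hcs, fun x hx => hx.2⟩
  obtain ⟨u, hu, -, huQ⟩ := exists_antitone_seq_forall_exists hstep
    ⟨K, hK, hKc, subset_rfl, hφ0, hψ0⟩
  have hu' : Antitone fun n => (u n).1 := fun m n h => hu h
  have hne : ∀ n, (u n).1.Nonempty := fun n => by
    rw [Set.nonempty_iff_ne_empty]
    intro h
    have := (u n).2.2.2.2.2
    simp [h] at this
  have hL0 : (⋂ n, (u n).1).Nonempty :=
    IsCompact.nonempty_iInter_of_sequence_nonempty_isCompact_isClosed _
      (fun n => hu' n.le_succ) hne (u 0).2.1 fun n => (u n).2.1.isClosed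
  obtain ⟨x₀, e, he, hxe⟩ := exists_direction_of_mul_eq_mul hL0 fun x hx y hy z hz i j => by
    rcases eq_or_ne i j with rfl | hij
    · rfl
    · refine mul_eq_mul_of_rational_halfspaces (fun a b => ?_) hx hy hz
      obtain ⟨n, c, s, hcs, hn⟩ := huQ ⟨⟨(i, j), hij⟩, a, b⟩
      exact ⟨c, s, hcs, fun w hw => hn w (Set.mem_iInter.1 hw n)⟩
  exact ⟨fun n => (u n).1, x₀, e, hu', fun n => (u n).2, he, hxe⟩

theorem mul_setIntegral_sq_le_of_contDiff {d : ℕ} {K : Set (EuclideanSpace ℝ (Fin d))}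
    (hK : IsCompact K) (hKc : Convex ℝ K) {κ : ℝ} (hκ : 0 < κ) (hκK : κ * Metric.diam K < Real.pi)
    {q : EuclideanSpace ℝ (Fin d) → ℝ} (hq : ContDiff ℝ 1 q) (hq0 : ∫ x in K, q x = 0) :
    κ ^ 2 * ∫ x in K, q x ^ 2 ≤ ∫ x in K, ‖fderiv ℝ q x‖ ^ 2 := by
  by_contra! hlt
  have hqc := hq.continuous
  have hdc : Continuous (fderiv ℝ q) := hq.continuous_fderiv one_ne_zero
  have hint : ∀ {A : Set (EuclideanSpace ℝ (Fin d))} {f : EuclideanSpace ℝ (Fin d) → ℝ},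
      IsCompact A → Continuous f → IntegrableOn f A :=
    fun hA hf => hf.continuousOn.integrableOn_compact hA
  set δ := κ ^ 2 * (∫ x in K, q x ^ 2) - ∫ x in K, ‖fderiv ℝ q x‖ ^ 2 with hδ
  have hδ0 : 0 < δ := sub_pos.2 hlt
  set ε := δ / (volume.real K + 1) with hε
  have hε0 : 0 < ε := by positivity
  have hψint : ∀ {A : Set (EuclideanSpace ℝ (Fin d))}, IsCompact A →
      ∫ x in A, (κ ^ 2 * q x ^ 2 - ‖fderiv ℝ q x‖ ^ 2 - ε) =
        κ ^ 2 * (∫ x in A, q x ^ 2) - (∫ x in A, ‖fderiv ℝ q x‖ ^ 2) - ε * volume.real A := by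
    intro A hA
    rw [integral_sub, integral_sub, integral_const_mul, setIntegral_const, smul_eq_mul, mul_comm ε]
    · exact hint hA (by fun_prop)
    · exact hint hA (by fun_prop)
    · exact hint hA (by fun_prop)
    · exact hint hA (by fun_prop)
  obtain ⟨u, x₀, e, hu, hun, he, hxe⟩ := exists_needle hK hKc hqc
    (ψ := fun x => κ ^ 2 * q x ^ 2 - ‖fderiv ℝ q x‖ ^ 2 - ε) (by fun_prop) hq0 (by
      rw [hψint hK, ← hδ, sub_pos, hε, div_mul_eq_mul_div, div_lt_iff₀ (by positivity)]
      nlinarith)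
  set l : EuclideanSpace ℝ (Fin d) →L[ℝ] ℝ := innerSL ℝ e with hl
  have hlx : ∀ x, l x = inner ℝ e x := fun x => rfl
  set γ : ℝ → EuclideanSpace ℝ (Fin d) := fun s => x₀ + (s - inner ℝ e x₀) • e with hγ
  have hγd : ∀ s, HasDerivAt γ e s := fun s => by
    have h := (((hasDerivAt_id s).sub_const (inner ℝ e x₀)).smul_const e).const_add x₀
    rwa [one_smul] at h
  have hγc : Continuous γ := by fun_prop
  set g : ℝ → ℝ := fun s => q (γ s) with hg
  set g' : ℝ → ℝ := fun s => fderiv ℝ q (γ s) e with hg'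
  have hgd : ∀ s, HasDerivAt g (g' s) s := fun s =>
    ((hq.differentiable one_ne_zero (γ s)).hasFDerivAt).comp_hasDerivAt s (hγd s)
  have hg'c : Continuous g' := by fun_prop
  have hgc : Continuous g := by fun_prop
  set η := min 1 (ε / (2 * (κ ^ 2 + 2))) with hη
  have hη0 : 0 < η := lt_min one_pos (by positivity)
  have hη1 : η ≤ 1 := min_le_left _ _
  have hηε : η * (κ ^ 2 + 2) < ε := by
    have := (le_div_iff₀ (by positivity)).1 (min_le_right 1 (ε / (2 * (κ ^ 2 + 2))))
    rw [← hη] at this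
    nlinarith
  set U : Set (EuclideanSpace ℝ (Fin d)) := {x | κ ^ 2 * q x ^ 2 - κ ^ 2 * g (l x) ^ 2 < η} ∩
    ({x | |q x - g (l x)| < η} ∩ {x | g' (l x) ^ 2 - ‖fderiv ℝ q x‖ ^ 2 < η}) with hU
  have hUo : IsOpen U := (isOpen_lt (by fun_prop) continuous_const).inter
    ((isOpen_lt (by fun_prop) continuous_const).inter (isOpen_lt (by fun_prop) continuous_const))
  obtain ⟨n, hn⟩ := exists_subset_nhds_of_isCompact (V := u) hu.directed_ge
    (fun n => (hun n).1) (U := U) fun x hx => hUo.mem_nhds (by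
      have hx' : γ (l x) = x := hxe x hx
      have hb : |fderiv ℝ q x e| ≤ ‖fderiv ℝ q x‖ :=
        (le_trans ((fderiv ℝ q x).le_opNorm e) (mul_le_of_le_one_right (norm_nonneg _) he))
      refine ⟨?_, ?_, ?_⟩
      · simp [hg, hx', hη0]
      · simp [hg, hx', hη0]
      · have := sq_le_sq' (neg_le_of_abs_le hb) (le_of_abs_le hb)
        change fderiv ℝ q (γ (l x)) e ^ 2 - _ < η
        rw [hx']
        linarith)
  obtain ⟨hA, hAc, hAK, hA0, hA1⟩ := hun n
  generalize u n = A at *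
  have hAne : A.Nonempty := by
    rw [Set.nonempty_iff_ne_empty]
    rintro rfl
    simp at hA1
  rw [hψint hA] at hA1
  obtain ⟨y, hy, hymin⟩ := hA.exists_isMinOn hAne l.continuous.continuousOn
  obtain ⟨z, hz, hzmax⟩ := hA.exists_isMaxOn hAne l.continuous.continuousOn
  have hyz : l z - l y ≤ Metric.diam K := by
    rw [← map_sub, hlx]
    refine (real_inner_le_norm _ _).trans ((mul_le_of_le_one_left (norm_nonneg _) he).trans ?_)
    rw [← dist_eq_norm]
    exact Metric.dist_le_diam_of_mem hK.isBounded (hAK hz) (hAK hy)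
  have key := wirtinger_variance_comp_linear hA hAc l (a := l y) (b := l z) (hymin hz) hκ
    ((mul_le_mul_of_nonneg_left hyz hκ.le).trans_lt hκK) (fun x hx => ⟨hymin hx, hzmax hx⟩)
    hgd hg'c
  set V := volume.real A with hV
  have hVt : volume A ≠ ⊤ := hA.measure_lt_top.ne
  have hV0 : 0 ≤ V := measureReal_nonneg
  have hmono : ∀ {f : EuclideanSpace ℝ (Fin d) → ℝ}, Continuous f → (∀ x ∈ A, f x ≤ η) →
      ∫ x in A, f x ≤ η * V := by
    intro f hf h
    have := setIntegral_mono_on (hint hA hf) (hint hA (continuous_const (y := η)))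
      hA.measurableSet h
    rwa [setIntegral_const, smul_eq_mul, mul_comm] at this
  have b1 : κ ^ 2 * (∫ x in A, q x ^ 2) - κ ^ 2 * (∫ x in A, g (l x) ^ 2) ≤ η * V := by
    have := hmono (f := fun x => κ ^ 2 * q x ^ 2 - κ ^ 2 * g (l x) ^ 2) (by fun_prop)
      fun x hx => (hn hx).1.le
    rwa [integral_sub (hint hA (by fun_prop)) (hint hA (by fun_prop)), integral_const_mul,
      integral_const_mul] at this
  have b2 : (∫ x in A, g' (l x) ^ 2) - (∫ x in A, ‖fderiv ℝ q x‖ ^ 2) ≤ η * V := by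
    have := hmono (f := fun x => g' (l x) ^ 2 - ‖fderiv ℝ q x‖ ^ 2) (by fun_prop)
      fun x hx => (hn hx).2.2.le
    rwa [integral_sub (hint hA (by fun_prop)) (hint hA (by fun_prop))] at this
  have hclose : ∀ x ∈ A, |q x - g (l x)| ≤ η := fun x hx => le_of_lt (hn hx).2.1
  have b3 : |∫ x in A, g (l x)| ≤ η * V := by
    rw [abs_le]
    constructor
    · have := hmono (f := fun x => q x - g (l x)) (by fun_prop)
        fun x hx => le_of_abs_le (hclose x hx)
      rw [integral_sub (hint hA (by fun_prop)) (hint hA (by fun_prop)), hA0] at this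
      linarith
    · have := hmono (f := fun x => g (l x) - q x) (by fun_prop)
        fun x hx => by linarith [neg_le_of_abs_le (hclose x hx)]
      rw [integral_sub (hint hA (by fun_prop)) (hint hA (by fun_prop)), hA0] at this
      linarith
  have b4 : (∫ x in A, g (l x)) ^ 2 ≤ (η * V) ^ 2 :=
    sq_le_sq' (neg_le_of_abs_le b3) (le_of_abs_le b3)
  rcases hV0.eq_or_lt with hVz | hVpos
  · have : volume.restrict A = 0 := by
      rw [Measure.restrict_eq_zero]
      exact (measureReal_eq_zero_iff hVt).1 hVz.symm
    rw [this, ← hVz] at hA1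
    simp at hA1
  · have key2 : κ ^ 2 * (∫ x in A, g (l x) ^ 2) ≤ κ ^ 2 * η ^ 2 * V + ∫ x in A, g' (l x) ^ 2 := by
      refine le_of_mul_le_mul_left ?_ hVpos
      nlinarith [mul_le_mul_of_nonneg_left b4 (sq_nonneg κ)]
    have : ε * V < (κ ^ 2 * η ^ 2 + 2 * η) * V := by nlinarith
    have := lt_of_mul_lt_mul_right this hV0
    nlinarith [mul_nonneg (mul_nonneg (sq_nonneg κ) hη0.le) (sub_nonneg.2 hη1)]

theorem exists_contDiff_eventuallyEq {E : Type*} [NormedAddCommGroup E] [NormedSpace ℝ E]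
    [FiniteDimensional ℝ E] {K C : Set E} (hK : IsOpen K) (hC : IsClosed C) (hCK : C ⊆ K)
    {q : E → ℝ} (hq : ContDiffOn ℝ 1 q K) :
    ∃ p : E → ℝ, ContDiff ℝ 1 p ∧ ∀ x ∈ C, p =ᶠ[nhds x] q := by
  obtain ⟨χ, h0, h1, -⟩ := exists_contMDiffMap_zero_one_nhds_of_isClosed (n := 1)
    (modelWithCornersSelf ℝ E) hK.isClosed_compl hC (Set.disjoint_compl_left_iff_subset.2 hCK)
  have hχ : ContDiff ℝ 1 χ := χ.contMDiff.contDiff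
  refine ⟨fun x => χ x * q x, contDiff_iff_contDiffAt.2 fun x => ?_, fun x hx => ?_⟩
  · by_cases hx : x ∈ K
    · exact hχ.contDiffAt.mul (hq.contDiffAt (hK.mem_nhds hx))
    · refine (contDiffAt_const (c := (0 : ℝ))).congr_of_eventuallyEq ?_
      filter_upwards [eventually_nhdsSet_iff_forall.1 h0 x hx] with y hy
      rw [hy, zero_mul]
  · filter_upwards [eventually_nhdsSet_iff_forall.1 h1 x hx] with y hy
    rw [hy, one_mul]

theorem isClosed_setOf_ball_subset {E : Type*} [NormedAddCommGroup E] {K : Set E} (r : ℝ) :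
    IsClosed {x | Metric.ball x r ⊆ K} := by
  have : {x | Metric.ball x r ⊆ K} = ⋂ y ∈ Kᶜ, {x | r ≤ dist y x} := by
    ext x
    simp only [Set.mem_iInter]
    change (Metric.ball x r ⊆ K) ↔ ∀ y ∈ Kᶜ, r ≤ dist y x
    exact ⟨fun h y hy => not_lt.1 fun hlt => hy (h hlt), fun h y hy => by
      by_contra hyK
      exact not_lt.2 (h y hyK) hy⟩
  rw [this]
  exact isClosed_biInter fun y _ => isClosed_le continuous_const (by fun_prop)

theorem Convex.setOf_ball_subset {E : Type*} [NormedAddCommGroup E] [NormedSpace ℝ E] {K : Set E}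
    (hK : Convex ℝ K) (r : ℝ) : Convex ℝ {x | Metric.ball x r ⊆ K} := by
  intro x hx y hy a b ha hb hab z hz
  set v := z - (a • x + b • y) with hv
  have hvr : ‖v‖ < r := by rwa [hv, ← dist_eq_norm]
  have hz' : z = a • (x + v) + b • (y + v) := by
    have : a • v + b • v = v := by rw [← add_smul, hab, one_smul]
    rw [smul_add, smul_add, add_add_add_comm, this, hv, add_sub_cancel]
  rw [hz']
  exact hK (hx (by simpa using hvr)) (hy (by simpa using hvr)) ha hb hab

theorem mul_variance_le_of_contDiffOn_of_isCompact {d : ℕ}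
    {K C : Set (EuclideanSpace ℝ (Fin d))} (hK : IsOpen K) (hC : IsCompact C) (hCc : Convex ℝ C)
    (hCK : C ⊆ K) {κ : ℝ} (hκ : 0 < κ) (hκC : κ * Metric.diam C < Real.pi)
    {q : EuclideanSpace ℝ (Fin d) → ℝ} (hq : ContDiffOn ℝ 1 q K) :
    κ ^ 2 * (volume.real C * (∫ x in C, q x ^ 2) - (∫ x in C, q x) ^ 2) ≤
      volume.real C * ∫ x in C, ‖fderiv ℝ q x‖ ^ 2 := by
  obtain ⟨p, hp, hpq⟩ := exists_contDiff_eventuallyEq hK hC.isClosed hCK hq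
  have e1 : ∫ x in C, q x = ∫ x in C, p x :=
    setIntegral_congr_fun hC.measurableSet fun x hx => (hpq x hx).self_of_nhds.symm
  have e2 : ∫ x in C, q x ^ 2 = ∫ x in C, p x ^ 2 :=
    setIntegral_congr_fun hC.measurableSet fun x hx => by
      simp only [(hpq x hx).self_of_nhds]
  have e3 : ∫ x in C, ‖fderiv ℝ q x‖ ^ 2 = ∫ x in C, ‖fderiv ℝ p x‖ ^ 2 :=
    setIntegral_congr_fun hC.measurableSet fun x hx => by
      simp only [(hpq x hx).fderiv_eq]
  rw [e1, e2, e3]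
  have hint : ∀ {f : EuclideanSpace ℝ (Fin d) → ℝ}, Continuous f → IntegrableOn f C :=
    fun hf => hf.continuousOn.integrableOn_compact hC
  have hpc := hp.continuous
  rcases (measureReal_nonneg (μ := volume) (s := C)).eq_or_lt with hV | hV
  · rw [← hV]
    simp only [zero_mul, zero_sub, mul_neg, Left.neg_nonpos_iff]
    positivity
  set m := (∫ x in C, p x) / volume.real C with hm
  have hmV : m * volume.real C = ∫ x in C, p x := div_mul_cancel₀ _ hV.ne'
  have h0 : ∫ x in C, (p x - m) = 0 := by
    rw [integral_sub (hint hpc) (hint continuous_const), setIntegral_const, smul_eq_mul,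
      mul_comm _ m, hmV, sub_self]
  have key := mul_setIntegral_sq_le_of_contDiff hC hCc hκ hκC (hp.sub contDiff_const) h0
  simp only [fderiv_sub_const] at key
  have e4 : ∫ x in C, (p x - m) ^ 2 = (∫ x in C, p x ^ 2) - m * ∫ x in C, p x := by
    have : ∀ x, (p x - m) ^ 2 = p x ^ 2 - (2 * m) * p x + m ^ 2 := fun x => by ring
    simp only [this]
    rw [integral_add, integral_sub, integral_const_mul, setIntegral_const, smul_eq_mul, ← hmV]
    · ring
    all_goals exact hint (by fun_prop)
  rw [e4] at key
  refine le_trans (le_of_eq ?_) (mul_le_mul_of_nonneg_left key hV.le)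
  rw [← hmV]
  ring

theorem mul_setIntegral_sq_le_of_contDiffOn {d : ℕ} {K : Set (EuclideanSpace ℝ (Fin d))}
    (hK : IsOpen K) (hKc : Convex ℝ K) (hKb : Bornology.IsBounded K)
    {q : EuclideanSpace ℝ (Fin d) → ℝ} (hq : ContDiffOn ℝ 1 q K)
    (hint2 : IntegrableOn (fun x => q x ^ 2) K)
    (hintg : IntegrableOn (fun x => ‖fderiv ℝ q x‖ ^ 2) K) (hq0 : ∫ x in K, q x = 0)
    {κ : ℝ} (hκ : 0 < κ) (hκK : κ * Metric.diam K < Real.pi) :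
    κ ^ 2 * ∫ x in K, q x ^ 2 ≤ ∫ x in K, ‖fderiv ℝ q x‖ ^ 2 := by
  have hfin : volume K < ⊤ := hKb.measure_lt_top
  set A : ℕ → Set (EuclideanSpace ℝ (Fin d)) :=
    fun n => {x | Metric.ball x (1 / ((n : ℝ) + 1)) ⊆ K} with hA
  have hAK : ∀ n, A n ⊆ K := fun n x hx => hx (Metric.mem_ball_self (by positivity))
  have hAcl : ∀ n, IsClosed (A n) := fun n => isClosed_setOf_ball_subset _
  have hAcp : ∀ n, IsCompact (A n) := fun n =>
    Metric.isCompact_of_isClosed_isBounded (hAcl n) (hKb.subset (hAK n))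
  have hcov : AECover (volume.restrict K) Filter.atTop A := by
    refine ⟨(ae_restrict_iff' hK.measurableSet).2 (.of_forall fun x hx => ?_),
      fun n => (hAcl n).measurableSet⟩
    obtain ⟨ρ, hρ, hball⟩ := Metric.isOpen_iff.1 hK x hx
    filter_upwards [(tendsto_one_div_add_atTop_nhds_zero_nat (𝕜 := ℝ)).eventually_lt_const hρ]
      with n hn
    exact (Metric.ball_subset_ball hn.le).trans hball
  have hlim : ∀ {f : EuclideanSpace ℝ (Fin d) → ℝ}, IntegrableOn f K →
      Filter.Tendsto (fun n => ∫ x in A n, f x) Filter.atTop (nhds (∫ x in K, f x)) := by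
    intro f hf
    refine (hcov.integral_tendsto_of_countably_generated hf).congr fun n => ?_
    rw [Measure.restrict_restrict (hAcl n).measurableSet, Set.inter_eq_left.2 (hAK n)]
  have : IsFiniteMeasure (volume.restrict K) := ⟨by rwa [Measure.restrict_apply_univ]⟩
  have hqint : IntegrableOn q K := by
    have hm : AEStronglyMeasurable q (volume.restrict K) :=
      hq.continuousOn.aestronglyMeasurable hK.measurableSet
    exact ((memLp_two_iff_integrable_sq hm).2 hint2).integrable one_le_two
  have hvol : Filter.Tendsto (fun n => volume.real (A n)) Filter.atTop
      (nhds (volume.real K)) := by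
    simpa using hlim (f := fun _ => 1) (integrable_const _)
  have hlimit := le_of_tendsto_of_tendsto'
    (((hvol.mul (hlim hint2)).sub ((hlim hqint).pow 2)).const_mul (κ ^ 2))
    (hvol.mul (hlim hintg)) fun n =>
      mul_variance_le_of_contDiffOn_of_isCompact hK (hAcp n) (hKc.setOf_ball_subset _) (hAK n) hκ
        ((mul_le_mul_of_nonneg_left (Metric.diam_mono (hAK n) hKb) hκ.le).trans_lt hκK) hq
  rw [hq0] at hlimit
  rcases (measureReal_nonneg (μ := volume) (s := K)).eq_or_lt with hV | hV
  · have : volume.restrict K = 0 := by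
      rw [Measure.restrict_eq_zero]
      exact (measureReal_eq_zero_iff hfin.ne).1 hV.symm
    simp [this]
  · refine le_of_mul_le_mul_left ?_ hV
    linarith

theorem stmt_5
    {d : ℕ} (K : Set (EuclideanSpace ℝ (Fin d)))
    (hKopen : IsOpen K) (hKconv : Convex ℝ K) (hKbdd : Bornology.IsBounded K)
    (q : EuclideanSpace ℝ (Fin d) → ℝ)
    (hq : ContDiffOn ℝ 1 q K)
    (hint2 : IntegrableOn (fun x => (q x) ^ 2) K volume)
    (hintg : IntegrableOn (fun x => ‖fderiv ℝ q x‖ ^ 2) K volume)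
    (hmean : ∫ x in K, q x = 0) :
    Real.sqrt (∫ x in K, (q x) ^ 2) ≤
      (Metric.diam K / Real.pi) * Real.sqrt (∫ x in K, ‖fderiv ℝ q x‖ ^ 2) ∧
    Real.sqrt (∫ x in K, (q x) ^ 2) ≤
      Metric.diam K * Real.sqrt (∫ x in K, ‖fderiv ℝ q x‖ ^ 2) := by
  have hD : 0 ≤ Metric.diam K := Metric.diam_nonneg
  have hlt : ∀ t, Metric.diam K / Real.pi < t → Real.sqrt (∫ x in K, (q x) ^ 2) ≤
      t * Real.sqrt (∫ x in K, ‖fderiv ℝ q x‖ ^ 2) := by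
    intro t ht
    have ht0 : 0 < t := (div_nonneg hD Real.pi_pos.le).trans_lt ht
    have h := mul_setIntegral_sq_le_of_contDiffOn hKopen hKconv hKbdd hq hint2 hintg hmean
      (inv_pos.2 ht0) (by
        rw [inv_mul_lt_iff₀ ht0]
        exact (div_lt_iff₀ Real.pi_pos).1 ht)
    rw [inv_pow, inv_mul_le_iff₀ (by positivity)] at h
    refine (Real.sqrt_le_sqrt h).trans_eq ?_
    rw [Real.sqrt_mul (sq_nonneg t), Real.sqrt_sq ht0.le]
  have hmain : Real.sqrt (∫ x in K, (q x) ^ 2) ≤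
      (Metric.diam K / Real.pi) * Real.sqrt (∫ x in K, ‖fderiv ℝ q x‖ ^ 2) :=
    ge_of_tendsto ((continuous_mul_const _).continuousWithinAt (s := Set.Ioi _)).tendsto
      (eventually_nhdsWithin_of_forall hlt)
  exact ⟨hmain, hmain.trans (mul_le_mul_of_nonneg_right
    (div_le_self hD (by linarith [Real.pi_gt_three])) (Real.sqrt_nonneg _))⟩
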